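/- arXiv:2406.12149 — 2 statements merged into one kernel-verified Lean document; each statement's English description precedes it below -/
import Mathlib

section
/- Let k ≥ 2, n ≥ 1 be integers and Δ a real number with 0 ≤ Δ ≤ n/(2(k−1)). Let P be a length-n ROBP over alphabet [k] that computes ApproxCount_k[n,Δ], and let Φ_n be the potential of the last layer defined from the rectangle labeling of P. Then Φ_n ≤ binom(n+k−1, k) − C(n − 2(k−1)Δ + k−1, k), where C(x,k) denotes the generalized binomial coefficient x(x−1)⋯(x−k+1)/k! for a real x. -/
open Finset

/-- A length-`n` read-once branching program over alphabet `σ` with outputs in `Out`.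
Layer `t` has vertex set `Fin (size t)` (only layers `0, 1, …, n` are relevant);
layer `0` consists of a single start vertex, and each vertex of layer `t` has an
outgoing edge to layer `t+1` for every letter of the alphabet. -/
structure ROBP (σ Out : Type) (n : ℕ) where
  size : ℕ → ℕ
  size0 : size 0 = 1
  sizePos : ∀ t, 0 < size t
  step : (t : ℕ) → Fin (size t) → σ → Fin (size (t + 1))
  out : Fin (size n) → Out

namespace ROBP

variable {σ Out : Type} {n : ℕ}

/-- The vertex reached in layer `t` on input `x` (only `x 0, …, x (t-1)` matter). -/
def state (P : ROBP σ Out n) (x : ℕ → σ) : (t : ℕ) → Fin (P.size t)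
  | 0 => ⟨0, P.sizePos 0⟩
  | t + 1 => P.step t (state P x t) (x t)

/-- The width of an ROBP: the maximal number of vertices in a single layer. -/
def width (P : ROBP σ Out n) : ℕ := (Finset.range (n + 1)).sup P.size

/-- Every vertex (in the relevant layers) is reached by some input: no useless vertices. -/
def Reachable (P : ROBP σ Out n) : Prop :=
  ∀ t, t ≤ n → ∀ v : Fin (P.size t), ∃ x : ℕ → σ, P.state x t = v

/-- The output of the program on input `x`. -/
def eval (P : ROBP σ Out n) (x : ℕ → σ) : Out := P.out (P.state x n)

end ROBP

/-- The number of occurrences of `j` among `x 0, …, x (t-1)`. -/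
def countK {k : ℕ} (x : ℕ → Fin k) (t : ℕ) (j : Fin k) : ℕ :=
  ((Finset.range t).filter fun i => x i = j).card

/-- `P` computes `ApproxCount_k[n, Δ]`: on every input, each of the `k` outputs estimates
the frequency of the corresponding letter within additive error `Δ`. -/
def ComputesApproxCountK (k n : ℕ) (Δ : ℝ) (P : ROBP (Fin k) (Fin k → ℝ) n) : Prop :=
  ∀ x : ℕ → Fin k, ∀ j : Fin k, |P.eval x j - (countK x n j : ℝ)| ≤ Δ

/-- `P` computes `ApproxCount[n, Δ]` (the `{0,1}` case). -/
def ComputesApproxCount (n : ℕ) (Δ : ℝ) (P : ROBP Bool ℝ n) : Prop :=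
  ∀ x : ℕ → Bool, |P.eval x - (((Finset.range n).filter fun i => x i = true).card : ℝ)| ≤ Δ

/-- The number of `1`'s in coordinate `j` among `x 0, …, x (t-1)`. -/
def countPar {k : ℕ} (x : ℕ → (Fin k → Bool)) (t : ℕ) (j : Fin k) : ℕ :=
  ((Finset.range t).filter fun i => x i j = true).card

/-- `P` computes `ApproxCount^par_k[n, Δ]`. -/
def ComputesApproxCountPar (k n : ℕ) (Δ : ℝ) (P : ROBP (Fin k → Bool) (Fin k → ℝ) n) : Prop :=
  ∀ x : ℕ → (Fin k → Bool), ∀ j : Fin k, |P.eval x j - (countPar x n j : ℝ)| ≤ Δ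

/-- The inclusion `[k-1] ⊆ [k]`. -/
def idx {k : ℕ} (j : Fin (k - 1)) : Fin k := Fin.castLE (Nat.sub_le k 1) j

/-- `a_j(v)`: the minimal possible number of `j`'s in the first `t` input words
reaching the vertex `v` of layer `t`. -/
noncomputable def rectLo {k n : ℕ} (P : ROBP (Fin k) (Fin k → ℝ) n) (t : ℕ)
    (v : Fin (P.size t)) (j : Fin (k - 1)) : ℕ :=
  sInf {c | ∃ x : ℕ → Fin k, P.state x t = v ∧ countK x t (idx j) = c}

/-- `b_j(v)`: the maximal possible number of `j`'s in the first `t` input words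
reaching the vertex `v` of layer `t`. -/
noncomputable def rectHi {k n : ℕ} (P : ROBP (Fin k) (Fin k → ℝ) n) (t : ℕ)
    (v : Fin (P.size t)) (j : Fin (k - 1)) : ℕ :=
  sSup {c | ∃ x : ℕ → Fin k, P.state x t = v ∧ countK x t (idx j) = c}

/-- `a_j(v)` for the `k`-parallel case. -/
noncomputable def parLo {k n : ℕ} (P : ROBP (Fin k → Bool) (Fin k → ℝ) n) (t : ℕ)
    (v : Fin (P.size t)) (j : Fin k) : ℕ :=
  sInf {c | ∃ x : ℕ → (Fin k → Bool), P.state x t = v ∧ countPar x t j = c}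

/-- `b_j(v)` for the `k`-parallel case. -/
noncomputable def parHi {k n : ℕ} (P : ROBP (Fin k → Bool) (Fin k → ℝ) n) (t : ℕ)
    (v : Fin (P.size t)) (j : Fin k) : ℕ :=
  sSup {c | ∃ x : ℕ → (Fin k → Bool), P.state x t = v ∧ countPar x t j = c}

/-- The axis-parallel box `[lo 1, hi 1] × ⋯ × [lo m, hi m]` (as a set of integer points). -/
def rect {m : ℕ} (lo hi : Fin m → ℕ) : Set (Fin m → ℕ) :=
  {y | ∀ j, lo j ≤ y j ∧ y j ≤ hi j}

/-- The potential `φ_t(x)` of the point `x` (k-counter case): the maximum, over all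
rectangle labels of layer `t` containing `x`, of `min{Σ_j b_j, t} - Σ_j x_j`. -/
noncomputable def phiK {k n : ℕ} (P : ROBP (Fin k) (Fin k → ℝ) n) (t : ℕ)
    (x : Fin (k - 1) → ℕ) : ℕ :=
  Finset.univ.sup fun v : Fin (P.size t) =>
    if ∀ j, rectLo P t v j ≤ x j ∧ x j ≤ rectHi P t v j then
      min (∑ j, rectHi P t v j) t - ∑ j, x j
    else 0

/-- `T_{t,k}`: tuples of naturals summing to at most `t`. -/
def Tset (k t : ℕ) : Finset (Fin (k - 1) → ℕ) :=
  (Fintype.piFinset fun _ => Finset.range (t + 1)).filter fun x => ∑ j, x j ≤ t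

/-- The total potential `Φ_t` of layer `t` (k-counter case). -/
noncomputable def PhiK {k n : ℕ} (P : ROBP (Fin k) (Fin k → ℝ) n) (t : ℕ) : ℕ :=
  ∑ x ∈ Tset k t, phiK P t x

/-- The potential `φ_t(x)` of the point `x` (k-parallel case). -/
noncomputable def phiPar {k n : ℕ} (P : ROBP (Fin k → Bool) (Fin k → ℝ) n) (t : ℕ)
    (x : Fin k → ℕ) : ℕ :=
  Finset.univ.sup fun v : Fin (P.size t) =>
    if ∀ j, parLo P t v j ≤ x j ∧ x j ≤ parHi P t v j then
      (∑ j, parHi P t v j) - ∑ j, x j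
    else 0

/-- The total potential `Φ_t` of layer `t` (k-parallel case): the sum of `φ_t(x)`
over `x ∈ {0, 1, …, ⌊n/10⌋}^k`. -/
noncomputable def PhiPar {k n : ℕ} (P : ROBP (Fin k → Bool) (Fin k → ℝ) n) (t : ℕ) : ℕ :=
  ∑ x ∈ Fintype.piFinset (fun _ : Fin k => Finset.range (n / 10 + 1)), phiPar P t x

/-- The generalized binomial coefficient `C(x, m) = x (x-1) ⋯ (x-m+1) / m!`. -/
noncomputable def genChoose (x : ℝ) (m : ℕ) : ℝ :=
  (∏ i ∈ Finset.range m, (x - (i : ℝ))) / (Nat.factorial m : ℝ)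

theorem card_Tset (k t : ℕ) (hk : 1 ≤ k) : (Tset k t).card = (t + (k - 1)).choose (k - 1) := by
  have e : Tset k t ≃ {f : Fin (k - 1 + 1) → ℕ // ∑ i, f i = t} :=
    { toFun := fun x => ⟨Fin.cons (t - ∑ j, x.1 j) x.1, by
        have := (Finset.mem_filter.1 x.2).2
        simp only [Fin.sum_univ_succ, Fin.cons_zero, Fin.cons_succ]
        omega⟩
      invFun := fun f => ⟨Fin.tail f.1, by
        have hf := f.2
        rw [Fin.sum_univ_succ] at hf
        have hs : ∑ j, Fin.tail f.1 j ≤ t := by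
          simp only [Fin.tail]
          omega
        refine Finset.mem_filter.2 ⟨Fintype.mem_piFinset.2 fun j => ?_, hs⟩
        exact Finset.mem_range.2 (Nat.lt_succ_of_le
          ((Finset.single_le_sum (fun _ _ => Nat.zero_le _) (Finset.mem_univ j)).trans hs))⟩
      left_inv := fun x => by simp
      right_inv := fun f => by
        have hf := f.2
        rw [Fin.sum_univ_succ] at hf
        apply Subtype.ext
        funext i
        refine Fin.cases ?_ (fun j => ?_) i
        · simp only [Fin.cons_zero, Fin.tail]
          omega
        · simp [Fin.tail] }
  rw [← Fintype.card_coe, ← Nat.card_eq_fintype_card, Nat.card_congr e,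
    ← Nat.card_congr (Sym.equivNatSumOfFintype (Fin (k - 1 + 1)) t), Nat.card_eq_fintype_card,
    Sym.card_sym_eq_choose, Fintype.card_fin, ← Nat.choose_symm_of_eq_add]
  · congr 1
    omega
  · omega

theorem sum_Tset_sub (k n m : ℕ) (hk : 1 ≤ k) (hm : m ≤ n) :
    ∑ x ∈ Tset k n, (m - ∑ j, x j) = (m + k - 1).choose k := by
  induction m with
  | zero => simp [Nat.choose_eq_zero_of_lt (by omega : k - 1 < k)]
  | succ m ih =>
    have hsub : (Tset k n).filter (fun x => ∑ j, x j ≤ m) = Tset k m := by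
      ext x
      simp only [Tset, Finset.mem_filter, Fintype.mem_piFinset, Finset.mem_range]
      refine ⟨fun h => ⟨fun j => ?_, h.2⟩, fun h => ⟨⟨fun j => ?_, ?_⟩, h.2⟩⟩
      · exact Nat.lt_succ_of_le
          ((Finset.single_le_sum (fun _ _ => Nat.zero_le _) (Finset.mem_univ j)).trans h.2)
      · have := h.1 j
        omega
      · have := h.2
        omega
    have hstep : ∀ x : Fin (k - 1) → ℕ,
        m + 1 - ∑ j, x j = (m - ∑ j, x j) + if ∑ j, x j ≤ m then 1 else 0 := by
      intro x
      split_ifs <;> omega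
    rw [Finset.sum_congr rfl fun x _ => hstep x, Finset.sum_add_distrib, ih (by omega),
      ← Finset.card_filter, hsub, card_Tset k m hk]
    obtain ⟨k, rfl⟩ := Nat.exists_eq_add_of_le' hk
    have h1 : m + 1 + (k + 1) - 1 = m + k + 1 := by omega
    have h2 : m + (k + 1) - 1 = m + k := by omega
    rw [h1, h2, Nat.add_sub_cancel, Nat.choose_succ_succ, add_comm]

theorem genChoose_natCast (a m : ℕ) : genChoose (a : ℝ) m = (a.choose m : ℝ) := by
  rw [genChoose, Nat.cast_choose_eq_descPochhammer_div, descPochhammer_eval_eq_prod_range]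

theorem genChoose_le_genChoose {x y : ℝ} {m : ℕ} (hx : (m : ℝ) - 1 ≤ x) (hxy : x ≤ y) :
    genChoose x m ≤ genChoose y m := by
  refine div_le_div_of_nonneg_right (Finset.prod_le_prod (fun i hi => ?_) fun i _ => ?_)
    (Nat.cast_nonneg _)
  · have : (i : ℝ) + 1 ≤ m := by exact_mod_cast Finset.mem_range.1 hi
    linarith
  · linarith

theorem countK_le {k : ℕ} (x : ℕ → Fin k) (t : ℕ) (j : Fin k) : countK x t j ≤ t :=
  (Finset.card_filter_le _ _).trans (Finset.card_range t).le

theorem rectHi_le_rectLo_add {k n : ℕ} {Δ : ℝ} {P : ROBP (Fin k) (Fin k → ℝ) n}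
    (hreach : P.Reachable) (hcomp : ComputesApproxCountK k n Δ P)
    (v : Fin (P.size n)) (j : Fin (k - 1)) :
    rectHi P n v j ≤ rectLo P n v j + ⌊2 * Δ⌋₊ := by
  obtain ⟨x₀, hx₀⟩ := hreach n le_rfl v
  have hne : {c | ∃ x : ℕ → Fin k, P.state x n = v ∧ countK x n (idx j) = c}.Nonempty :=
    ⟨_, x₀, hx₀, rfl⟩
  have hbdd : BddAbove {c | ∃ x : ℕ → Fin k, P.state x n = v ∧ countK x n (idx j) = c} := by
    refine ⟨n, ?_⟩
    rintro _ ⟨x, -, rfl⟩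
    exact countK_le x n _
  obtain ⟨x, hx, hxlo⟩ : ∃ x, P.state x n = v ∧ countK x n (idx j) = rectLo P n v j :=
    Nat.sInf_mem hne
  obtain ⟨y, hy, hyhi⟩ : ∃ y, P.state y n = v ∧ countK y n (idx j) = rectHi P n v j :=
    Nat.sSup_mem hne hbdd
  have h1 := abs_le.1 (hcomp x (idx j))
  have h2 := abs_le.1 (hcomp y (idx j))
  rw [ROBP.eval, hx, hxlo] at h1
  rw [ROBP.eval, hy, hyhi] at h2
  rw [← Nat.sub_le_iff_le_add']
  apply Nat.le_floor
  rcases le_total (rectHi P n v j) (rectLo P n v j) with h | h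
  · rw [Nat.sub_eq_zero_of_le h, Nat.cast_zero]
    linarith
  · rw [Nat.cast_sub h]
    linarith

theorem phiK_le {k n : ℕ} {Δ : ℝ} {P : ROBP (Fin k) (Fin k → ℝ) n}
    (hreach : P.Reachable) (hcomp : ComputesApproxCountK k n Δ P) (x : Fin (k - 1) → ℕ) :
    phiK P n x ≤ min ((k - 1) * ⌊2 * Δ⌋₊) (n - ∑ j, x j) := by
  refine Finset.sup_le fun v _ => ?_
  split_ifs with h
  · refine le_min ?_ (Nat.sub_le_sub_right (min_le_right _ _) _)
    have hsum : ∑ j, rectHi P n v j ≤ ∑ j, (x j + ⌊2 * Δ⌋₊) :=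
      Finset.sum_le_sum fun j _ =>
        (rectHi_le_rectLo_add hreach hcomp v j).trans (Nat.add_le_add_right (h j).1 _)
    rw [Finset.sum_add_distrib, Finset.sum_const, Finset.card_univ, Fintype.card_fin,
      smul_eq_mul] at hsum
    have := min_le_left (∑ j, rectHi P n v j) n
    omega
  · exact Nat.zero_le _

theorem PhiK_add_choose_le {k n d : ℕ} {P : ROBP (Fin k) (Fin k → ℝ) n} (hk : 1 ≤ k)
    (hphi : ∀ x, phiK P n x ≤ min d (n - ∑ j, x j)) :
    PhiK P n + (n - d + k - 1).choose k ≤ (n + k - 1).choose k := by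
  rw [← sum_Tset_sub k n (n - d) hk (Nat.sub_le _ _), ← sum_Tset_sub k n n hk le_rfl, PhiK,
    ← Finset.sum_add_distrib]
  refine Finset.sum_le_sum fun x _ => ?_
  have := le_min_iff.1 (hphi x)
  omega

/-- Implication of large `Φ_n`: if `P` computes `ApproxCount_k[n,Δ]`
with `0 ≤ Δ ≤ n/(2(k-1))`, then
`Φ_n ≤ binom(n+k-1, k) - C(n - 2(k-1)Δ + k-1, k)`. -/
theorem stmt4 (k n : ℕ) (hk : 2 ≤ k) (hn : 1 ≤ n)
    (Δ : ℝ) (hΔ0 : 0 ≤ Δ) (hΔ1 : Δ ≤ (n : ℝ) / (2 * ((k : ℝ) - 1)))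
    (P : ROBP (Fin k) (Fin k → ℝ) n) (hreach : P.Reachable)
    (hcomp : ComputesApproxCountK k n Δ P) :
    (PhiK P n : ℝ) ≤
      (Nat.choose (n + k - 1) k : ℝ) -
        genChoose ((n : ℝ) - 2 * ((k : ℝ) - 1) * Δ + (k : ℝ) - 1) k := by
  have hk1 : (1 : ℝ) < k := by exact_mod_cast hk
  have hΔn : 2 * ((k : ℝ) - 1) * Δ ≤ n := by
    rw [le_div_iff₀ (by linarith)] at hΔ1
    linarith
  set d : ℕ := (k - 1) * ⌊2 * Δ⌋₊ with hd
  have hdΔ : (d : ℝ) ≤ 2 * ((k : ℝ) - 1) * Δ := by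
    have := mul_le_mul_of_nonneg_left (Nat.floor_le (by linarith : 0 ≤ 2 * Δ))
      (by linarith : (0 : ℝ) ≤ (k : ℝ) - 1)
    rw [hd, Nat.cast_mul, Nat.cast_sub (by omega), Nat.cast_one]
    linarith
  have hdn : d ≤ n := by exact_mod_cast hdΔ.trans hΔn
  have hmain : (PhiK P n : ℝ) + ((n - d + k - 1).choose k : ℝ) ≤ ((n + k - 1).choose k : ℝ) := by
    exact_mod_cast PhiK_add_choose_le (by omega) (phiK_le hreach hcomp)
  have hcast : ((n - d + k - 1 : ℕ) : ℝ) = (n : ℝ) - d + k - 1 := by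
    rw [Nat.cast_sub (by omega), Nat.cast_add, Nat.cast_sub hdn, Nat.cast_one]
  have hgen : genChoose ((n : ℝ) - 2 * ((k : ℝ) - 1) * Δ + (k : ℝ) - 1) k
      ≤ ((n - d + k - 1).choose k : ℝ) := by
    rw [← genChoose_natCast, hcast]
    exact genChoose_le_genChoose (by linarith) (by linarith)
  linarith
end

section
/- There exists an absolute constant A > 0 such that for all integers k ≥ 2, n ≥ 10k, w ≥ 1 and every real Δ with 1 ≤ Δ ≤ n/(10(k−1)): if there exists a length-n width-w ROBP over alphabet [k] that computes ApproxCount_k[n,Δ], then w ≥ C(n + k − 1 − 2(k−1)Δ − A·√(nΔ), k−1), where C(x,k−1) denotes the generalized binomial coefficient x(x−1)⋯(x−k+2)/(k−1)! for a real x. -/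
open Finset

theorem ROBP.state_congr {σ Out : Type} {n : ℕ} (P : ROBP σ Out n) {x y : ℕ → σ} {t : ℕ}
    (h : ∀ i < t, x i = y i) : P.state x t = P.state y t := by
  induction t with
  | zero => rfl
  | succ t ih =>
    simp only [ROBP.state]
    rw [ih fun i hi => h i (by omega), h t (by omega)]

theorem ROBP.state_update_succ {σ Out : Type} {n : ℕ} (P : ROBP σ Out n) (x : ℕ → σ) (t : ℕ)
    (i : σ) : P.state (Function.update x t i) (t + 1) = P.step t (P.state x t) i := by
  simp only [ROBP.state, Function.update_self]
  rw [P.state_congr (y := x) fun l hl => Function.update_of_ne hl.ne _ _]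

theorem countK_update_succ {k : ℕ} (x : ℕ → Fin k) (t : ℕ) (i j : Fin k) :
    countK (Function.update x t i) (t + 1) j = countK x t j + if i = j then 1 else 0 := by
  unfold countK
  rw [Finset.range_add_one, Finset.filter_insert]
  have h : (Finset.range t).filter (fun l => Function.update x t i l = j) =
      (Finset.range t).filter fun l => x l = j := by
    refine Finset.filter_congr fun l hl => ?_
    rw [Function.update_of_ne (Finset.mem_range.1 hl).ne]
  rw [h, Function.update_self]
  split_ifs with hij
  · rw [Finset.card_insert_of_notMem (by simp)]
  · simp

section Rectangle

variable {k n : ℕ} (P : ROBP (Fin k) (Fin k → ℝ) n)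

theorem rectLo_le_countK (x : ℕ → Fin k) (t : ℕ) (j : Fin (k - 1)) :
    rectLo P t (P.state x t) j ≤ countK x t (idx j) :=
  Nat.sInf_le ⟨x, rfl, rfl⟩

theorem bddAbove_counts (t : ℕ) (v : Fin (P.size t)) (j : Fin (k - 1)) :
    BddAbove {c | ∃ x : ℕ → Fin k, P.state x t = v ∧ countK x t (idx j) = c} :=
  ⟨t, by rintro c ⟨x, -, rfl⟩; exact countK_le x t _⟩

theorem countK_le_rectHi (x : ℕ → Fin k) (t : ℕ) (j : Fin (k - 1)) :
    countK x t (idx j) ≤ rectHi P t (P.state x t) j :=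
  le_csSup (bddAbove_counts P t _ j) ⟨x, rfl, rfl⟩

variable {P}

theorem exists_countK_eq_rectLo (hP : P.Reachable) {t : ℕ} (ht : t ≤ n) (v : Fin (P.size t))
    (j : Fin (k - 1)) :
    ∃ x : ℕ → Fin k, P.state x t = v ∧ countK x t (idx j) = rectLo P t v j := by
  obtain ⟨x, hx⟩ := hP t ht v
  exact Nat.sInf_mem
    (s := {c | ∃ x : ℕ → Fin k, P.state x t = v ∧ countK x t (idx j) = c}) ⟨_, x, hx, rfl⟩

theorem exists_countK_eq_rectHi (hP : P.Reachable) {t : ℕ} (ht : t ≤ n) (v : Fin (P.size t))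
    (j : Fin (k - 1)) :
    ∃ x : ℕ → Fin k, P.state x t = v ∧ countK x t (idx j) = rectHi P t v j := by
  obtain ⟨x, hx⟩ := hP t ht v
  exact Nat.sSup_mem
    (s := {c | ∃ x : ℕ → Fin k, P.state x t = v ∧ countK x t (idx j) = c}) ⟨_, x, hx, rfl⟩
    (bddAbove_counts P t v j)

theorem rectLo_step_le (hP : P.Reachable) {t : ℕ} (ht : t ≤ n) (v : Fin (P.size t)) (i : Fin k)
    (j : Fin (k - 1)) :
    rectLo P (t + 1) (P.step t v i) j ≤ rectLo P t v j + if i = idx j then 1 else 0 := by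
  obtain ⟨x, rfl, hx⟩ := exists_countK_eq_rectLo hP ht v j
  rw [← hx, ← countK_update_succ, ← P.state_update_succ]
  exact rectLo_le_countK P _ _ _

theorem le_rectHi_step (hP : P.Reachable) {t : ℕ} (ht : t ≤ n) (v : Fin (P.size t)) (i : Fin k)
    (j : Fin (k - 1)) :
    (rectHi P t v j + if i = idx j then 1 else 0) ≤ rectHi P (t + 1) (P.step t v i) j := by
  obtain ⟨x, rfl, hx⟩ := exists_countK_eq_rectHi hP ht v j
  rw [← hx, ← countK_update_succ, ← P.state_update_succ]
  exact countK_le_rectHi P _ _ _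

theorem rectHi_sub_rectLo_le (hP : P.Reachable) {Δ : ℝ} (hΔ : ComputesApproxCountK k n Δ P)
    (v : Fin (P.size n)) (j : Fin (k - 1)) :
    (rectHi P n v j : ℝ) - rectLo P n v j ≤ 2 * Δ := by
  obtain ⟨x, hx, hxc⟩ := exists_countK_eq_rectLo hP le_rfl v j
  obtain ⟨y, hy, hyc⟩ := exists_countK_eq_rectHi hP le_rfl v j
  have h1 := abs_le.1 (hΔ x (idx j))
  have h2 := abs_le.1 (hΔ y (idx j))
  simp only [ROBP.eval, hx, hy, hxc, hyc] at h1 h2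
  linarith [h1.1, h1.2, h2.1, h2.2]

theorem idx_injective : Function.Injective (idx : Fin (k - 1) → Fin k) :=
  Fin.castLE_injective (Nat.sub_le k 1)

/-- Reading the last letter does not shrink the rectangle. -/
theorem exists_rect_subset (hk : 0 < k) (hP : P.Reachable) {t : ℕ} (ht : t ≤ n)
    (v : Fin (P.size t)) :
    ∃ u : Fin (P.size (t + 1)), ∀ j, rectLo P (t + 1) u j ≤ rectLo P t v j ∧
      rectHi P t v j ≤ rectHi P (t + 1) u j := by
  refine ⟨P.step t v ⟨k - 1, by omega⟩, fun j => ?_⟩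
  have hne : (⟨k - 1, by omega⟩ : Fin k) ≠ idx j := by
    intro h
    have := congrArg Fin.val h
    have hj := j.isLt
    simp [idx] at this
    omega
  have h1 := rectLo_step_le hP ht v ⟨k - 1, by omega⟩ j
  have h2 := le_rectHi_step hP ht v ⟨k - 1, by omega⟩ j
  rw [if_neg hne] at h1 h2
  exact ⟨h1, h2⟩

/-- If `y` lies in the rectangle of `v` and `y` is not its least corner, then `y` lies in a
rectangle of the next layer whose greatest corner has larger coordinate sum. -/
theorem exists_rect_sum_lt (hP : P.Reachable) {t : ℕ} (ht : t ≤ n)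
    (v : Fin (P.size t)) {y : Fin (k - 1) → ℕ} (hy : y ∈ rect (rectLo P t v) (rectHi P t v))
    {i : Fin (k - 1)} (hi : rectLo P t v i < y i) :
    ∃ u : Fin (P.size (t + 1)), y ∈ rect (rectLo P (t + 1) u) (rectHi P (t + 1) u) ∧
      ∑ j, rectHi P t v j < ∑ j, rectHi P (t + 1) u j := by
  refine ⟨P.step t v (idx i), fun j => ?_, ?_⟩
  · have h1 := rectLo_step_le hP ht v (idx i) j
    have h2 := le_rectHi_step hP ht v (idx i) j
    obtain ⟨h3, h4⟩ := hy j
    by_cases hij : i = j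
    · subst hij
      simp only [if_true] at h1 h2
      omega
    · rw [if_neg fun h => hij (idx_injective h)] at h1 h2
      omega
  · refine Finset.sum_lt_sum
      (fun j _ => (Nat.le_add_right _ _).trans (le_rectHi_step hP ht v (idx i) j))
      ⟨i, Finset.mem_univ _, ?_⟩
    have h2 := le_rectHi_step hP ht v (idx i) i
    simp only [if_true] at h2
    omega

theorem exists_mem_rect (hk : 0 < k) (hP : P.Reachable) {t : ℕ} (ht : t ≤ n)
    {y : Fin (k - 1) → ℕ} (hy : ∑ j, y j ≤ t) :
    ∃ v : Fin (P.size t), y ∈ rect (rectLo P t v) (rectHi P t v) := by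
  induction t generalizing y with
  | zero =>
    refine ⟨P.state (fun _ => ⟨0, hk⟩) 0, fun j => ?_⟩
    have h1 := rectLo_le_countK P (fun _ => ⟨0, hk⟩) 0 j
    have h0 : y j = 0 := by
      have := Finset.single_le_sum (fun i _ => Nat.zero_le (y i)) (Finset.mem_univ j)
      omega
    have h2 := countK_le (fun _ : ℕ => (⟨0, hk⟩ : Fin k)) 0 (idx j)
    omega
  | succ t ih =>
    rcases Nat.lt_or_ge t (∑ j, y j) with hlt | hle
    · obtain ⟨i, -, hi⟩ : ∃ i ∈ Finset.univ, y i ≠ 0 :=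
        Finset.exists_ne_zero_of_sum_ne_zero (by omega)
      have hsum : ∑ j, (y j - if i = j then 1 else 0) + 1 = ∑ j, y j := by
        have h1 : ∑ j, (if i = j then 1 else 0) = 1 := by simp
        refine (congrArg (_ + ·) h1.symm).trans ?_
        rw [← Finset.sum_add_distrib]
        refine Finset.sum_congr rfl fun j _ => ?_
        split_ifs with hij
        · subst hij
          omega
        · omega
      obtain ⟨v, hv⟩ := ih (by omega) (y := fun j => y j - if i = j then 1 else 0) (by omega)
      refine ⟨P.step t v (idx i), fun j => ?_⟩
      have h1 := rectLo_step_le hP (by omega) v (idx i) j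
      have h2 := le_rectHi_step hP (by omega) v (idx i) j
      obtain ⟨h3, h4⟩ := hv j
      by_cases hij : i = j
      · subst hij
        simp only [if_true] at h1 h2 h3 h4
        omega
      · rw [if_neg fun h => hij (idx_injective h)] at h1 h2
        simp only [if_neg hij] at h3 h4
        omega
    · obtain ⟨v, hv⟩ := ih (by omega) hle
      obtain ⟨u, hu⟩ := exists_rect_subset hk hP (by omega) v
      exact ⟨u, fun j => ⟨(hu j).1.trans (hv j).1, (hv j).2.trans (hu j).2⟩⟩

variable (P)

open Classical in
/-- The largest coordinate sum of the greatest corner of a rectangle of layer `t` containing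
`y`. -/
noncomputable def topSum (t : ℕ) (y : Fin (k - 1) → ℕ) : ℕ :=
  (Finset.univ.filter fun v : Fin (P.size t) => y ∈ rect (rectLo P t v) (rectHi P t v)).sup
    fun v => ∑ j, rectHi P t v j

variable {P}

theorem le_topSum {t : ℕ} {y : Fin (k - 1) → ℕ} {v : Fin (P.size t)}
    (hv : y ∈ rect (rectLo P t v) (rectHi P t v)) : ∑ j, rectHi P t v j ≤ topSum P t y := by
  classical
  exact Finset.le_sup (f := fun v => ∑ j, rectHi P t v j)
    (Finset.mem_filter.2 ⟨Finset.mem_univ _, hv⟩)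

theorem exists_eq_topSum (hk : 0 < k) (hP : P.Reachable) {t : ℕ} (ht : t ≤ n)
    {y : Fin (k - 1) → ℕ} (hy : ∑ j, y j ≤ t) :
    ∃ v : Fin (P.size t), y ∈ rect (rectLo P t v) (rectHi P t v) ∧
      topSum P t y = ∑ j, rectHi P t v j := by
  classical
  obtain ⟨v, hv⟩ := exists_mem_rect hk hP ht hy
  obtain ⟨u, hu, h⟩ := Finset.exists_mem_eq_sup
    (Finset.univ.filter fun v : Fin (P.size t) => y ∈ rect (rectLo P t v) (rectHi P t v))
    ⟨v, Finset.mem_filter.2 ⟨Finset.mem_univ _, hv⟩⟩ fun v => ∑ j, rectHi P t v j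
  exact ⟨u, (Finset.mem_filter.1 hu).2, h⟩

theorem sum_le_topSum (hk : 0 < k) (hP : P.Reachable) {t : ℕ} (ht : t ≤ n)
    {y : Fin (k - 1) → ℕ} (hy : ∑ j, y j ≤ t) : ∑ j, y j ≤ topSum P t y := by
  obtain ⟨v, hv⟩ := exists_mem_rect hk hP ht hy
  exact (Finset.sum_le_sum fun j _ => (hv j).2).trans (le_topSum hv)

theorem topSum_le (hk : 0 < k) (hP : P.Reachable) {Δ : ℝ}
    (hΔ : ComputesApproxCountK k n Δ P) {y : Fin (k - 1) → ℕ} (hy : ∑ j, y j ≤ n) :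
    (topSum P n y : ℝ) ≤ ((∑ j, y j : ℕ) : ℝ) + 2 * ((k : ℝ) - 1) * Δ := by
  obtain ⟨v, hv, h⟩ := exists_eq_topSum hk hP le_rfl hy
  have hle : ∀ j ∈ Finset.univ, (rectHi P n v j : ℝ) ≤ (y j : ℝ) + 2 * Δ := by
    intro j _
    have h1 := rectHi_sub_rectLo_le hP hΔ v j
    have h2 : (rectLo P n v j : ℝ) ≤ y j := by exact_mod_cast (hv j).1
    linarith
  have hsum := Finset.sum_le_sum hle
  rw [Finset.sum_add_distrib, Finset.sum_const, Finset.card_univ, Fintype.card_fin,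
    nsmul_eq_mul, Nat.cast_sub hk] at hsum
  rw [h]
  push_cast at hsum ⊢
  linarith

/-- In one step, the total of `topSum` over `R` grows by at least `#R` minus the size of the
layer: it grows at every point that is not the least corner of a rectangle. -/
theorem sum_topSum_add_card_le (hk : 0 < k) (hP : P.Reachable) {t : ℕ} (ht : t ≤ n)
    {R : Finset (Fin (k - 1) → ℕ)} (hR : ∀ y ∈ R, ∑ j, y j ≤ t) :
    ∑ y ∈ R, topSum P t y + R.card ≤ ∑ y ∈ R, topSum P (t + 1) y + P.size t := by
  classical
  set L : Finset (Fin (k - 1) → ℕ) := Finset.univ.image (rectLo P t)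
  have hpt : ∀ y ∈ R, topSum P t y + 1 ≤ topSum P (t + 1) y + if y ∈ L then 1 else 0 := by
    intro y hy
    obtain ⟨v, hv, h⟩ := exists_eq_topSum hk hP ht (hR y hy)
    rw [h]
    split_ifs with hyL
    · obtain ⟨u, hu⟩ := exists_rect_subset hk hP ht v
      have hyu : y ∈ rect (rectLo P (t + 1) u) (rectHi P (t + 1) u) :=
        fun j => ⟨(hu j).1.trans (hv j).1, (hv j).2.trans (hu j).2⟩
      exact Nat.add_le_add_right
        ((Finset.sum_le_sum fun j _ => (hu j).2).trans (le_topSum hyu)) 1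
    · obtain ⟨i, hi⟩ : ∃ i, rectLo P t v i < y i := by
        by_contra! hcon
        exact hyL (Finset.mem_image.2
          ⟨v, Finset.mem_univ _, funext fun j => le_antisymm (hv j).1 (hcon j)⟩)
      obtain ⟨u, hu, hlt⟩ := exists_rect_sum_lt hP ht v hv hi
      exact Nat.succ_le_of_lt (hlt.trans_le (le_topSum hu))
  have hsum := Finset.sum_le_sum hpt
  rw [Finset.sum_add_distrib, Finset.sum_add_distrib, ← Finset.card_eq_sum_ones,
    ← Finset.card_filter] at hsum
  have hcard : (R.filter fun y => y ∈ L).card ≤ P.size t := by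
    calc (R.filter fun y => y ∈ L).card ≤ L.card :=
          Finset.card_le_card fun y hy => (Finset.mem_filter.1 hy).2
      _ ≤ P.size t := Finset.card_image_le.trans (by simp)
  omega

theorem sum_topSum_add_mul_card_le (hk : 0 < k) (hP : P.Reachable) {s : ℕ}
    {R : Finset (Fin (k - 1) → ℕ)} (hR : ∀ y ∈ R, ∑ j, y j ≤ s) {d : ℕ} (hd : s + d ≤ n) :
    ∑ y ∈ R, topSum P s y + d * R.card ≤ ∑ y ∈ R, topSum P (s + d) y + d * P.width := by
  induction d with
  | zero => simp
  | succ d ih =>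
    have h1 := ih (by omega)
    have h2 := sum_topSum_add_card_le hk hP (t := s + d) (by omega)
      (R := R) fun y hy => (hR y hy).trans (by omega)
    have h3 : P.size (s + d) ≤ P.width :=
      Finset.le_sup (f := P.size) (Finset.mem_range.2 (by omega))
    rw [add_mul, add_mul, ← add_assoc s]
    omega

theorem mul_card_le_mul_width (hk : 0 < k) (hP : P.Reachable) {Δ : ℝ}
    (hΔ : ComputesApproxCountK k n Δ P) {s d : ℕ} (hd : s + d = n)
    {R : Finset (Fin (k - 1) → ℕ)} (hR : ∀ y ∈ R, ∑ j, y j ≤ s) :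
    (R.card : ℝ) * (d - 2 * ((k : ℝ) - 1) * Δ) ≤ d * P.width := by
  have h1 := sum_topSum_add_mul_card_le hk hP hR hd.le
  rw [hd] at h1
  have h2 : ∑ y ∈ R, ∑ j, y j ≤ ∑ y ∈ R, topSum P s y :=
    Finset.sum_le_sum fun y hy => sum_le_topSum hk hP (by omega) (hR y hy)
  have h3 := Finset.sum_le_sum fun y (hy : y ∈ R) =>
    topSum_le hk hP hΔ (y := y) ((hR y hy).trans (by omega))
  rw [Finset.sum_add_distrib, Finset.sum_const, nsmul_eq_mul] at h3
  have h4 : ((∑ y ∈ R, ∑ j, y j : ℕ) : ℝ) + d * R.card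
      ≤ ((∑ y ∈ R, topSum P n y : ℕ) : ℝ) + d * P.width := by
    exact_mod_cast (Nat.add_le_add_right h2 _).trans h1
  rw [Nat.cast_sum, Nat.cast_sum] at h4
  linarith

end Rectangle

theorem sum_le_of_mem_Tset {k s : ℕ} {y : Fin (k - 1) → ℕ} (hy : y ∈ Tset k s) :
    ∑ j, y j ≤ s :=
  (Finset.mem_filter.1 hy).2

theorem choose_le_card_Tset (m s : ℕ) : (s + m).choose m ≤ (Tset (m + 1) s).card := by
  have hcard : Fintype.card (Sym (Fin (m + 1)) s) = (s + m).choose m := by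
    rw [Sym.card_sym_eq_choose, Fintype.card_fin, show m + 1 + s - 1 = s + m by omega,
      Nat.choose_symm_add]
  have hsum : ∀ σ : Sym (Fin (m + 1)) s,
      ∑ j : Fin m, (σ : Multiset (Fin (m + 1))).count j.castSucc +
        (σ : Multiset (Fin (m + 1))).count (Fin.last m) = s := by
    intro σ
    rw [← Fin.sum_univ_castSucc fun j => (σ : Multiset (Fin (m + 1))).count j,
      Multiset.sum_count_eq_card fun _ _ => Finset.mem_univ _]
    exact σ.2
  rw [← hcard, ← Finset.card_univ]
  refine Finset.card_le_card_of_injOn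
    (fun σ (j : Fin m) => (σ : Multiset (Fin (m + 1))).count j.castSucc) ?_ ?_
  · intro σ _
    have h : ∑ j : Fin m, (σ : Multiset (Fin (m + 1))).count j.castSucc ≤ s := by
      have := hsum σ
      omega
    refine Finset.mem_coe.2 (Finset.mem_filter.2 ⟨Fintype.mem_piFinset.2 fun j => ?_, h⟩)
    refine Finset.mem_range.2 (Nat.lt_succ_of_le (le_trans ?_ h))
    exact Finset.single_le_sum
      (f := fun j : Fin m => (σ : Multiset (Fin (m + 1))).count j.castSucc)
      (fun i _ => Nat.zero_le _) (Finset.mem_univ j)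
  · intro σ _ τ _ h
    have hc : ∀ j : Fin m, (σ : Multiset (Fin (m + 1))).count j.castSucc =
        (τ : Multiset (Fin (m + 1))).count j.castSucc := fun j => congrFun h j
    refine Subtype.ext (Multiset.ext.2 fun a => ?_)
    induction a using Fin.lastCases with
    | last =>
      have h1 := hsum σ
      have h2 := hsum τ
      rw [Finset.sum_congr rfl fun j _ => hc j] at h1
      exact Nat.add_left_cancel (h1.trans h2.symm)
    | cast j => exact hc j

/-- Lowering the upper index `a` of `a.choose m` by `d` costs a factor `1 + m * (d / a)`. -/
theorem genChoose_mul_le_choose {m a : ℕ} (hma : m < a) {x d : ℝ} (hd : 0 ≤ d)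
    (hx : (m : ℝ) - 1 ≤ x) (hxa : x ≤ a - d) :
    genChoose x m * (1 + m * (d / a)) ≤ a.choose m := by
  have ha : (0 : ℝ) < a := by exact_mod_cast (Nat.zero_le m).trans_lt hma
  have hda : 0 ≤ d / a := by positivity
  have hnn : ∀ i ∈ Finset.range m, 0 ≤ x - (i : ℝ) := by
    intro i hi
    have : (i : ℝ) + 1 ≤ m := by exact_mod_cast Finset.mem_range.1 hi
    linarith
  have hpt : ∀ i ∈ Finset.range m, (x - (i : ℝ)) * (1 + d / a) ≤ a - (i : ℝ) := by
    intro i hi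
    have h1 : x - (i : ℝ) ≤ a := by
      have : (0 : ℝ) ≤ i := Nat.cast_nonneg i
      linarith
    have h2 := mul_le_mul_of_nonneg_right h1 hda
    have h3 : (a : ℝ) * (d / a) = d := by field_simp
    linarith
  have hchoose : (a.choose m : ℝ) = (∏ i ∈ Finset.range m, ((a : ℝ) - i)) / m.factorial := by
    rw [eq_div_iff (by positivity), mul_comm]
    have h := Nat.descFactorial_eq_factorial_mul_choose a m
    rw [Nat.descFactorial_eq_prod_range] at h
    rw [← Nat.cast_mul, ← h, Nat.cast_prod]
    refine Finset.prod_congr rfl fun i hi => ?_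
    rw [Nat.cast_sub ((Finset.mem_range.1 hi).le.trans hma.le)]
  rw [hchoose, genChoose, div_mul_eq_mul_div]
  refine div_le_div_of_nonneg_right ?_ (by positivity)
  calc (∏ i ∈ Finset.range m, (x - (i : ℝ))) * (1 + m * (d / a))
      ≤ (∏ i ∈ Finset.range m, (x - (i : ℝ))) * (1 + d / a) ^ m :=
        mul_le_mul_of_nonneg_left (one_add_mul_le_pow (by linarith) m)
          (Finset.prod_nonneg hnn)
    _ = ∏ i ∈ Finset.range m, (x - (i : ℝ)) * (1 + d / a) := by
        rw [Finset.prod_mul_distrib, Finset.prod_const, Finset.card_range]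
    _ ≤ ∏ i ∈ Finset.range m, ((a : ℝ) - i) :=
        Finset.prod_le_prod (fun i hi => mul_nonneg (hnn i hi) (by linarith)) hpt

theorem abs_prod_range_sub_le {m : ℕ} {x : ℝ} (h0 : 0 ≤ x) (hx : x ≤ m) :
    |∏ i ∈ Finset.range m, (x - (i : ℝ))| ≤ m.factorial := by
  induction m generalizing x with
  | zero => simp
  | succ m ih =>
    rw [Nat.factorial_succ, Nat.cast_mul]
    push_cast at hx ⊢
    have hf : (0 : ℝ) ≤ m.factorial := Nat.cast_nonneg _
    rcases le_or_gt x m with hxm | hxm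
    · rw [Finset.prod_range_succ, abs_mul, mul_comm]
      refine mul_le_mul (abs_le.2 ⟨?_, ?_⟩) (ih h0 hxm) (abs_nonneg _) (by positivity) <;> linarith
    · rcases Nat.eq_zero_or_pos m with rfl | hm
      · simpa [abs_of_nonneg h0] using hx
      · have hm1 : (1 : ℝ) ≤ m := by exact_mod_cast hm
        have hshift : ∏ i ∈ Finset.range m, (x - ((i + 1 : ℕ) : ℝ)) =
            ∏ i ∈ Finset.range m, (x - 1 - (i : ℝ)) :=
          Finset.prod_congr rfl fun i _ => by push_cast; ring
        rw [Finset.prod_range_succ', abs_mul, mul_comm, hshift]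
        refine mul_le_mul (abs_le.2 ⟨?_, ?_⟩) (ih (by linarith) (by linarith)) (abs_nonneg _)
          (by positivity) <;> push_cast <;> linarith

theorem genChoose_le_one {m : ℕ} {x : ℝ} (h0 : 0 ≤ x) (hx : x ≤ m) : genChoose x m ≤ 1 := by
  rw [genChoose, div_le_one (by positivity)]
  exact (le_abs_self _).trans (abs_prod_range_sub_le h0 hx)

theorem genChoose_nonneg {m : ℕ} {x : ℝ} (hx : (m : ℝ) - 1 ≤ x) : 0 ≤ genChoose x m := by
  refine div_nonneg (Finset.prod_nonneg fun i hi => ?_) (by positivity)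
  have : (i : ℝ) + 1 ≤ m := by exact_mod_cast Finset.mem_range.1 hi
  linarith

/-- there is an absolute constant `A > 0` such that whenever a
length-`n` width-`w` ROBP over `[k]` computes `ApproxCount_k[n, Δ]`
(`k ≥ 2`, `n ≥ 10k`, `1 ≤ Δ ≤ n/(10(k-1))`), it holds that
`w ≥ C(n + k - 1 - 2(k-1)Δ - A·√(nΔ), k-1)`. -/
theorem stmt7 :
    ∃ A : ℝ, 0 < A ∧
      ∀ k n w : ℕ, 2 ≤ k → 10 * k ≤ n → 1 ≤ w →
        ∀ Δ : ℝ, 1 ≤ Δ → Δ ≤ (n : ℝ) / (10 * ((k : ℝ) - 1)) →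
          (∃ P : ROBP (Fin k) (Fin k → ℝ) n, P.Reachable ∧ P.width ≤ w ∧
            ComputesApproxCountK k n Δ P) →
          (w : ℝ) ≥ genChoose
            ((n : ℝ) + (k : ℝ) - 1 - 2 * ((k : ℝ) - 1) * Δ - A * Real.sqrt ((n : ℝ) * Δ))
            (k - 1) := by
  refine ⟨16 / 5, by norm_num, ?_⟩
  rintro k n w hk hn hw Δ hΔ1 hΔ ⟨P, hP, hwid, hcomp⟩
  obtain ⟨m, rfl⟩ : ∃ m, k = m + 1 := ⟨k - 1, by omega⟩
  have hm1 : (1 : ℝ) ≤ m := by exact_mod_cast (by omega : 1 ≤ m)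
  have hn20 : (20 : ℝ) ≤ n := by exact_mod_cast (by omega : 20 ≤ n)
  have hw1 : (1 : ℝ) ≤ w := by exact_mod_cast hw
  have hkm : ((m + 1 : ℕ) : ℝ) - 1 = m := by push_cast; ring
  rw [hkm, le_div_iff₀ (by positivity)] at hΔ
  set r := Real.sqrt ((n : ℝ) * Δ)
  have hr0 : 0 ≤ r := Real.sqrt_nonneg _
  have hrsq : r * r = n * Δ := Real.mul_self_sqrt (by positivity)
  have hr4 : 4 ≤ r := Real.le_sqrt_of_sq_le (by nlinarith)
  set x : ℝ := (n : ℝ) + ((m + 1 : ℕ) : ℝ) - 1 - 2 * (((m + 1 : ℕ) : ℝ) - 1) * Δ - 16 / 5 * r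
    with hxdef
  have hx : x = n + m - 2 * m * Δ - 16 / 5 * r := by rw [hxdef, add_sub_assoc, hkm]
  clear_value x
  rw [Nat.add_sub_cancel]
  rcases lt_or_ge x ((m : ℝ) - 1) with hxm | hxm
  · rcases le_or_gt 0 x with hx0 | hx0
    · exact (genChoose_le_one hx0 (by linarith)).trans hw1
    · rcases Nat.lt_or_ge 1 m with hm | hm
      · exfalso
        have hm2 : (2 : ℝ) ≤ m := by exact_mod_cast hm
        have hΔn : 20 * Δ ≤ n := by nlinarith
        have hrn : r ≤ n / 4 := by
          refine Real.sqrt_le_iff.2 ⟨by positivity, ?_⟩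
          nlinarith
        nlinarith
      · obtain rfl : m = 1 := by omega
        have hg : genChoose x 1 = x := by simp [genChoose]
        rw [hg]
        linarith
  · set d := Real.sqrt (2 * ((n : ℝ) * Δ))
    have hd0 : 0 ≤ d := Real.sqrt_nonneg _
    have hdsq : d * d = 2 * (n * Δ) := Real.mul_self_sqrt (by positivity)
    have hdr : d ≤ 1.415 * r := by
      refine Real.sqrt_le_iff.2 ⟨by positivity, ?_⟩
      nlinarith
    have hpos : 0 ≤ 2 * m * Δ + d := by positivity
    set h := ⌈2 * m * Δ + d⌉₊
    have hle : 2 * m * Δ + d ≤ h := Nat.le_ceil _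
    have hlt : (h : ℝ) < 2 * m * Δ + d + 1 := Nat.ceil_lt_add_one hpos
    have hhn : h < n := by
      have : (h : ℝ) < n := by linarith
      exact_mod_cast this
    obtain ⟨s, hs⟩ : ∃ s, s + h = n := ⟨n - h, by omega⟩
    have hsR : (s : ℝ) + h = n := by exact_mod_cast hs
    have hmΔ : (m : ℝ) ≤ m * Δ := le_mul_of_one_le_right (by positivity) hΔ1
    have hG := genChoose_mul_le_choose (m := m) (a := s + m) (by omega) hd0 hxm
      (by push_cast; linarith)
    have hG0 : 0 ≤ genChoose x m := genChoose_nonneg hxm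
    have hcard : ((s + m).choose m : ℝ) ≤ (Tset (m + 1) s).card := by
      exact_mod_cast choose_le_card_Tset m s
    have hR := mul_card_le_mul_width (by omega) hP hcomp hs
      (R := Tset (m + 1) s) fun y hy => sum_le_of_mem_Tset hy
    rw [hkm] at hR
    have hwR : (P.width : ℝ) ≤ w := by exact_mod_cast hwid
    have ha : (0 : ℝ) < (s + m : ℕ) := by push_cast; positivity
    have han : ((s + m : ℕ) : ℝ) ≤ n := by push_cast; linarith
    have hgap : 0 ≤ (h : ℝ) - 2 * m * Δ := by linarith
    have hfac : (h : ℝ) ≤ (1 + m * (d / (s + m : ℕ))) * (h - 2 * m * Δ) := by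
      have h1 : 2 * m * Δ ≤ m * (d / (s + m : ℕ)) * d := by
        rw [mul_div_assoc', div_mul_eq_mul_div, le_div_iff₀ ha, mul_assoc (m : ℝ) d d, hdsq]
        have := mul_le_mul_of_nonneg_left han (by positivity : 0 ≤ 2 * m * Δ)
        linarith
      have h2 : m * (d / (s + m : ℕ)) * d ≤ m * (d / (s + m : ℕ)) * (h - 2 * m * Δ) :=
        mul_le_mul_of_nonneg_left (by linarith) (by positivity)
      linarith
    have hh0 : (0 : ℝ) < h := by linarith
    refine le_of_mul_le_mul_left ?_ hh0
    calc (h : ℝ) * genChoose x m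
        ≤ (1 + m * (d / (s + m : ℕ))) * (h - 2 * m * Δ) * genChoose x m :=
          mul_le_mul_of_nonneg_right hfac hG0
      _ = genChoose x m * (1 + m * (d / (s + m : ℕ))) * (h - 2 * m * Δ) := by ring
      _ ≤ (Tset (m + 1) s).card * (h - 2 * m * Δ) :=
          mul_le_mul_of_nonneg_right (hG.trans hcard) hgap
      _ ≤ h * P.width := hR
      _ ≤ h * w := mul_le_mul_of_nonneg_left hwR hh0.le
end
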